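/- Assume the Continuum Hypothesis (𝔠 = ℵ₁). Then every trivial autohomeomorphism of ℕ* is a quotient of its inverse: for every mod-finite permutation p of ℕ, with induced homeomorphism p* of ℕ*, there exists a continuous surjection Q : ℕ* → ℕ* such that Q ∘ (p*)⁻¹ = p* ∘ Q. (Dually, every trivial automorphism of P(ω)/fin embeds in its inverse.) -/

import Mathlib

open Filter Topology

/-- The space of free (non-principal) ultrafilters on `D`, with the subspace
topology inherited from the space of all ultrafilters on `D`. -/
abbrev FreeUF (D : Type*) := {U : Ultrafilter D // (U : Filter D) ≤ Filter.cofinite}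

lemma finiteToOne_of_injective {D E : Type*} {f : D → E} (hf : Function.Injective f) (e : E) :
    (f ⁻¹' {e}).Finite := by
  apply Set.Subsingleton.finite
  intro a ha b hb
  simp only [Set.mem_preimage, Set.mem_singleton_iff] at ha hb
  exact hf (ha.trans hb.symm)

lemma map_le_cofinite {D : Type*} {f : D → D} (hf : ∀ d : D, (f ⁻¹' {d}).Finite)
    {U : Ultrafilter D} (hU : (U : Filter D) ≤ Filter.cofinite) :
    (Ultrafilter.map f U : Filter D) ≤ Filter.cofinite := by
  rw [Filter.le_cofinite_iff_compl_singleton_mem]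
  intro x
  have h1 : (f ⁻¹' {x})ᶜ ∈ (U : Filter D) := hU ((hf x).compl_mem_cofinite)
  rw [Ultrafilter.coe_map, Filter.mem_map]
  simpa [Set.preimage_compl] using h1

/-- The trivial map `f*` on free ultrafilters induced by a finite-to-one map `f`,
sending an ultrafilter to its pushforward. -/
def ufMap {D : Type*} (f : D → D) (hf : ∀ d : D, (f ⁻¹' {d}).Finite) (U : FreeUF D) :
    FreeUF D :=
  ⟨Ultrafilter.map f U.1, map_le_cofinite hf U.2⟩

/-- `X` has weight at most `c`: it has a topological basis of cardinality at most `c`. -/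
def HasWeightLE (X : Type) [TopologicalSpace X] (c : Cardinal) : Prop :=
  ∃ B : Set (Set X), TopologicalSpace.IsTopologicalBasis B ∧ Cardinal.mk B ≤ c

lemma exists_seq_dependent {α : Type*} (P : ℕ → α → Prop) (R : ℕ → α → α → Prop)
    (zero : ∃ a, P 0 a) (succ : ∀ n a, P n a → ∃ b, P (n + 1) b ∧ R n a b) :
    ∃ f : ℕ → α, (∀ n, P n (f n)) ∧ ∀ n, R n (f n) (f (n + 1)) := by
  choose a ha using zero
  choose! next hP hR using succ
  let f : ℕ → α := fun n => Nat.rec a next n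
  have hf : ∀ n, P n (f n) := fun n => by
    induction n with
    | zero => exact ha
    | succ n ih => exact hP n _ ih
  exact ⟨f, hf, fun n => hR n _ (hf n)⟩

section FiniteValued

variable {α : Type*} [Finite α]

lemma eventually_frequently_eq (f : ℕ → α) :
    ∀ᶠ k in atTop, ∃ᶠ j in atTop, f j = f k := by
  have h : ∀ s, ∀ᶠ k in atTop, f k = s → ∃ᶠ j in atTop, f j = s := by
    intro s
    by_cases hs : ∃ᶠ j in atTop, f j = s
    · exact Eventually.of_forall fun _ _ => hs
    · filter_upwards [not_frequently.1 hs] with k hk h using absurd h hk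
  filter_upwards [eventually_all.2 h] with k hk using hk _ rfl

lemma eventually_forall_exists_lt (f : ℕ → α) (K : ℕ) :
    ∀ᶠ M in atTop, ∀ P : α → Prop, (∃ᶠ k in atTop, P (f k)) → ∃ j, K ≤ j ∧ j < M ∧ P (f j) := by
  refine eventually_all.2 fun P => ?_
  by_cases hP : ∃ᶠ k in atTop, P (f k)
  · obtain ⟨j, hj, hPj⟩ := frequently_atTop.1 hP K
    filter_upwards [eventually_gt_atTop j] with M hM _ using ⟨j, hj, hM, hPj⟩
  · exact Eventually.of_forall fun _ h => absurd h hP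

lemma map_atTop_eq_principal (f : ℕ → α) :
    map f atTop = 𝓟 {s | ∃ᶠ k in atTop, f k = s} := by
  apply le_antisymm
  · exact le_principal_iff.2 (eventually_frequently_eq f)
  · intro T hT s hs
    obtain ⟨k, rfl, hk⟩ := (Frequently.and_eventually hs hT).exists
    exact hk

lemma map_atTop_eq_of_frequently_iff {f g : ℕ → α}
    (h : ∀ s, (∃ᶠ k in atTop, f k = s) ↔ ∃ᶠ k in atTop, g k = s) :
    map f atTop = map g atTop := by
  simp only [map_atTop_eq_principal, h]

end FiniteValued

lemma frequently_iff_of_map_eq {α : Type*} {f g : ℕ → α} (h : map f atTop = map g atTop)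
    (P : α → Prop) : (∃ᶠ k in atTop, P (f k)) ↔ ∃ᶠ k in atTop, P (g k) := by
  rw [← frequently_map (P := P), h, frequently_map]

lemma eventually_iff_of_map_eq {α : Type*} {f g : ℕ → α} (h : map f atTop = map g atTop)
    (P : α → Prop) : (∀ᶠ k in atTop, P (f k)) ↔ ∀ᶠ k in atTop, P (g k) := by
  rw [← eventually_map (P := P), h, eventually_map]

lemma map_comp_eq_of_map_eq {α β : Type*} {f g : ℕ → α} (h : map f atTop = map g atTop)
    (r : α → β) : map (fun k => r (f k)) atTop = map (fun k => r (g k)) atTop := by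
  change map (r ∘ f) atTop = map (r ∘ g) atTop
  rw [← map_map, h, map_map]

/-- Infinite binary sequences, representing subsets of `ℕ`. -/
abbrev BinSeq := ℕ → Bool

/-- The values at `k` and `k + 1` of the sequences `c x`, for `x` in a finite set `G`. -/
def forwardPattern (c : BinSeq → BinSeq) (G : Finset BinSeq) (k : ℕ) : G → Bool × Bool :=
  fun x => (c x k, c x (k + 1))

/-- The values at `k + 1` and `k` of the sequences `c x`, for `x` in a finite set `G`. -/
def backwardPattern (c : BinSeq → BinSeq) (G : Finset BinSeq) (k : ℕ) : G → Bool × Bool :=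
  fun x => (c x (k + 1), c x k)

/-- The forward patterns on `G` that occur infinitely often are exactly the backward patterns of
`e` on `G` that occur infinitely often. -/
def ReversesPatterns (e : BinSeq → BinSeq) (G : Finset BinSeq) : Prop :=
  map (forwardPattern id G) atTop = map (backwardPattern e G) atTop

lemma ReversesPatterns.mono {e : BinSeq → BinSeq} {G H : Finset BinSeq}
    (h : ReversesPatterns e H) (hGH : G ⊆ H) : ReversesPatterns e G :=
  map_comp_eq_of_map_eq h fun s (x : G) => s ⟨x, hGH x.2⟩

lemma ReversesPatterns.congr {e e' : BinSeq → BinSeq} {G : Finset BinSeq}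
    (h : ReversesPatterns e G) (heq : ∀ x ∈ G, e x = e' x) : ReversesPatterns e' G := by
  have : backwardPattern e' G = backwardPattern e G := by
    funext k x
    simp [backwardPattern, heq x x.2]
  rw [ReversesPatterns, this, h]

/-- `e` reverses the shift on `A`: it reverses the patterns of all finite subsets of `A`. -/
def ReversesOn (e : BinSeq → BinSeq) (A : Set BinSeq) : Prop :=
  ∀ G : Finset BinSeq, ↑G ⊆ A → ReversesPatterns e G

lemma exists_glued_reversesPatterns {B : ℕ → Finset BinSeq} (hB : Monotone B)
    {c : ℕ → BinSeq → BinSeq} (hc : ∀ n, ReversesPatterns (c n) (B n))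
    (hagree : ∀ n, ∃ᶠ k in atTop, ∀ x ∈ B n, c n x k = c (n + 1) x k) :
    ∃ N : ℕ → ℕ, ∀ n, ReversesPatterns (fun x k => c (N k) x k) (B n) := by
  have hrec : ∀ n, ∃ L, ∀ k ≥ L, ∃ᶠ j in atTop,
      backwardPattern (c n) (B n) j = backwardPattern (c n) (B n) k := fun n =>
    eventually_atTop.1 (eventually_frequently_eq _)
  choose L hL using hrec
  obtain ⟨t, ⟨ht0, ht⟩⟩ := exists_seq_dependent (fun n a => n = 0 → a = 0)
    (fun n a b => a < b ∧ L (n + 1) ≤ b ∧ (∀ x ∈ B n, c n x b = c (n + 1) x b) ∧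
      ∀ P : (B n → Bool × Bool) → Prop, (∃ᶠ k in atTop, P (backwardPattern (c n) (B n) k)) →
        ∃ j, a ≤ j ∧ j < b ∧ P (backwardPattern (c n) (B n) j)) ⟨0, fun _ => rfl⟩ (by
      intro n a _
      obtain ⟨b, hb, h1, h2, h3⟩ := ((hagree n).and_eventually
        ((eventually_gt_atTop a).and ((eventually_ge_atTop (L (n + 1))).and
        (eventually_forall_exists_lt (backwardPattern (c n) (B n)) a)))).exists
      exact ⟨b, by simp, h1, h2, hb, h3⟩)
  have hmono : StrictMono t := strictMono_nat_of_lt_succ fun n => (ht n).1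
  have hex : ∀ k, ∃ n, t n ≤ k ∧ k < t (n + 1) := by
    intro k
    have h : ∃ n, k < t n := ⟨k + 1, (Nat.lt_succ_self k).trans_le (hmono.id_le _)⟩
    have hpos : Nat.find h ≠ 0 := fun h0 => by
      have := Nat.find_spec h
      rw [h0, ht0 0 rfl] at this
      omega
    obtain ⟨n, hn⟩ := Nat.exists_eq_succ_of_ne_zero hpos
    refine ⟨n, not_lt.1 (Nat.find_min h (by omega)), ?_⟩
    have := Nat.find_spec h
    rwa [hn] at this
  choose N hN using hex
  have huniq : ∀ n k, t n ≤ k → k < t (n + 1) → N k = n := by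
    intro n k h1 h2
    have h3 : n < N k + 1 := hmono.lt_iff_lt.1 (h1.trans_lt (hN k).2)
    have h4 : N k < n + 1 := hmono.lt_iff_lt.1 ((hN k).1.trans_lt h2)
    omega
  have hpat : ∀ n k, t n ≤ k → k < t (n + 1) →
      backwardPattern (fun x k => c (N k) x k) (B n) k = backwardPattern (c n) (B n) k := by
    intro n k h1 h2
    funext x
    simp only [backwardPattern, huniq n k h1 h2, Prod.mk.injEq, and_true]
    rcases Nat.lt_or_ge (k + 1) (t (n + 1)) with h | h
    · rw [huniq n (k + 1) (by omega) h]
    · have hk : k + 1 = t (n + 1) := by omega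
      rw [hk, huniq (n + 1) _ le_rfl (ht (n + 1)).1, (ht n).2.2.1 x x.2]
  refine ⟨N, fun m => map_atTop_eq_of_frequently_iff fun s => ⟨fun hs => ?_, fun hs => ?_⟩⟩
  · refine frequently_atTop.2 fun a => ?_
    have hmn : B m ⊆ B (max m a) := hB (le_max_left _ _)
    obtain ⟨j, h1, h2, h3⟩ := (ht (max m a)).2.2.2 (fun s' => (fun x : B m => s' ⟨x, hmn x.2⟩) = s)
      ((frequently_iff_of_map_eq (hc (max m a))
        (fun s' => (fun x : B m => s' ⟨x, hmn x.2⟩) = s)).1 hs)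
    refine ⟨j, ?_, ?_⟩
    · exact ((le_max_right m a).trans (hmono.id_le _)).trans h1
    · rw [← h3, ← hpat _ j h1 h2]
      rfl
  · obtain ⟨k, hk, rfl⟩ := frequently_atTop.1 hs (t (m + 1))
    obtain ⟨h1, h2⟩ := hN k
    have hn : m + 1 < N k + 1 := hmono.lt_iff_lt.1 (hk.trans_lt h2)
    obtain ⟨n, hn'⟩ : ∃ n, N k = n + 1 := ⟨N k - 1, by omega⟩
    have hmn : B m ⊆ B (N k) := hB (by omega)
    have hLk : L (N k) ≤ k := by
      rw [hn'] at h1 ⊢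
      exact (ht n).2.1.trans h1
    have hfreq := hL (N k) k hLk
    rw [← hpat _ k h1 h2] at hfreq
    refine (frequently_iff_of_map_eq (hc (N k)) (fun s' => (fun x : B m => s' ⟨x, hmn x.2⟩) = _)).2
      (hfreq.mono fun j hj => ?_)
    rw [hj]
    rfl

lemma exists_periodic_reversesPatterns (G : Finset BinSeq) :
    ∃ c : BinSeq → BinSeq, ReversesPatterns c G ∧ ∃ p > 0, ∀ x k, c x (k + p) = c x k := by
  obtain ⟨K, hK⟩ := eventually_atTop.1 (eventually_frequently_eq (forwardPattern id G))
  obtain ⟨M, hMK, hM, hKM⟩ := ((hK K le_rfl).and_eventually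
    ((eventually_forall_exists_lt (forwardPattern id G) K).and (eventually_gt_atTop K))).exists
  have hp : 0 < M - K := by omega
  let c : BinSeq → BinSeq := fun x k => x (M - k % (M - K))
  have hval : ∀ x ∈ G, x M = x K := fun x hx => congrArg Prod.fst (congrFun hMK ⟨x, hx⟩)
  have hpat : ∀ k, backwardPattern c G k = forwardPattern id G (M - 1 - k % (M - K)) := by
    intro k
    have hlt := Nat.mod_lt k hp
    funext x
    have h2 : M - 1 - k % (M - K) + 1 = M - k % (M - K) := by omega
    simp only [backwardPattern, forwardPattern, c, id, h2, Prod.mk.injEq, and_true]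
    rcases Nat.lt_or_ge (k % (M - K) + 1) (M - K) with h | h
    · rw [show (k + 1) % (M - K) = k % (M - K) + 1 by
        rw [Nat.add_mod_eq_ite]
        have : 1 % (M - K) = 1 := Nat.mod_eq_of_lt (by omega)
        rw [this, if_neg (by omega)]]
      exact congrArg x.1 (by omega)
    · have h3 : (k + 1) % (M - K) = 0 := by
        have : k % (M - K) + 1 = M - K := by omega
        rw [← Nat.mod_add_mod, this, Nat.mod_self]
      rw [h3, Nat.sub_zero, hval x x.2]
      exact congrArg x.1 (by omega)
  refine ⟨c, map_atTop_eq_of_frequently_iff fun s => ⟨fun hs => ?_, fun hs => ?_⟩, M - K, hp,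
    fun x k => by simp [c]⟩
  · obtain ⟨j, h1, h2, h3⟩ := hM (· = s) hs
    refine frequently_atTop.2 fun a => ⟨M - 1 - j + (M - K) * a, ?_, ?_⟩
    · nlinarith
    · rw [hpat, ← h3]
      have : (M - 1 - j + (M - K) * a) % (M - K) = M - 1 - j := by
        rw [Nat.add_mul_mod_self_left, Nat.mod_eq_of_lt (by omega)]
      rw [this]
      congr 1
      omega
  · obtain ⟨k, rfl⟩ := hs.exists
    have hlt := Nat.mod_lt k hp
    rw [hpat]
    exact hK _ (by omega)

lemma exists_monotone_finset_seq {α : Type*} {A : Set α} (hA : A.Countable) :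
    ∃ B : ℕ → Finset α, Monotone B ∧ (∀ n, ↑(B n) ⊆ A) ∧
      ∀ G : Finset α, ↑G ⊆ A → ∃ n, G ⊆ B n := by
  classical
  rcases A.eq_empty_or_nonempty with rfl | hne
  · refine ⟨fun _ => ∅, monotone_const, by simp, fun G hG => ⟨0, ?_⟩⟩
    simpa using hG
  · obtain ⟨f, rfl⟩ := hA.exists_eq_range hne
    refine ⟨fun n => (Finset.range n).image f, fun m n h =>
      Finset.image_subset_image (Finset.range_mono h), fun n => ?_, fun G hG => ?_⟩
    · simp only [Finset.coe_image]
      exact Set.image_subset_range _ _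
    · choose! g hg using fun x (hx : x ∈ G) => hG hx
      refine ⟨G.sup g + 1, fun x hx => Finset.mem_image.2 ⟨g x, ?_, hg x hx⟩⟩
      exact Finset.mem_range.2 (Nat.lt_succ_of_le (Finset.le_sup (f := g) hx))

lemma exists_reversesOn_of_countable {A : Set BinSeq} (hA : A.Countable) :
    ∃ e, ReversesOn e A := by
  obtain ⟨B, hB, -, hBA⟩ := exists_monotone_finset_seq hA
  obtain ⟨c, hc, hagree⟩ := exists_seq_dependent
    (fun n (c : BinSeq → BinSeq) => ReversesPatterns c (B n) ∧ ∃ p > 0, ∀ x k, c x (k + p) = c x k)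
    (fun n c c' => ∃ᶠ k in atTop, ∀ x ∈ B n, c x k = c' x k)
    (exists_periodic_reversesPatterns _) (by
      rintro n c ⟨hc, p, hp, hper⟩
      obtain ⟨d, hd, q, hq, hqer⟩ := exists_periodic_reversesPatterns (B (n + 1))
      have hsub : B n ⊆ B (n + 1) := hB n.le_succ
      have hmul : ∀ (f : BinSeq → BinSeq) (r : ℕ), (∀ x k, f x (k + r) = f x k) →
          ∀ x k a, f x (k + r * a) = f x k := by
        intro f r hf x k a
        induction a with
        | zero => rfl
        | succ a ih => rw [Nat.mul_succ, ← Nat.add_assoc, hf, ih]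
      have h1 : ∃ᶠ k in atTop, (fun x : B n => (backwardPattern c (B n) k x).2) =
          fun x : B n => c x 0 := by
        refine frequently_atTop.2 fun a => ⟨0 + p * a, by nlinarith, ?_⟩
        funext x
        exact hmul c p hper x 0 a
      have h2 := (frequently_iff_of_map_eq hc (fun s => (fun x : B n => (s x).2) = _)).2 h1
      have h3 := (frequently_iff_of_map_eq hd
        (fun s => (fun x : B n => (s ⟨x, hsub x.2⟩).2) = fun x : B n => c x 0)).1 h2
      obtain ⟨k₀, hk₀⟩ := h3.exists
      refine ⟨fun x k => d x (k + k₀), ⟨?_, q, hq, fun x k => ?_⟩, ?_⟩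
      · have h : map (fun k => backwardPattern d (B (n + 1)) (k + k₀)) atTop =
            map (backwardPattern d (B (n + 1))) atTop := by
          change map (backwardPattern d (B (n + 1)) ∘ (· + k₀)) atTop = _
          rw [← map_map, map_add_atTop_eq_nat]
        rw [ReversesPatterns, hd.trans h.symm]
        congr 1
        funext k x
        simp only [backwardPattern, Nat.add_right_comm]
      · change d x (k + q + k₀) = d x (k + k₀)
        rw [← hqer x (k + k₀), Nat.add_right_comm]
      · refine frequently_atTop.2 fun a => ⟨0 + p * (q * a), ?_, fun x hx => ?_⟩
        · nlinarith [Nat.mul_le_mul hp (Nat.mul_le_mul hq (le_refl a))]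
        · rw [hmul c p hper, ← congrFun hk₀ ⟨x, hx⟩]
          have : 0 + p * (q * a) + k₀ = k₀ + q * (p * a) := by ring
          simp only [this, hmul d q hqer]
          rfl)
  obtain ⟨N, hN⟩ := exists_glued_reversesPatterns hB (fun n => (hc n).1) hagree
  refine ⟨fun x k => c (N k) x k, fun G hG => ?_⟩
  obtain ⟨n, hn⟩ := hBA G hG
  exact (hN n).mono hn

/-- Every finite set `G` of sequences has a copy in `A`, fixing the elements of `A`, in which the
same patterns occur infinitely often. -/
def Reflecting (A : Set BinSeq) : Prop :=
  ∀ G : Finset BinSeq, ∃ g : BinSeq → BinSeq, (∀ x ∈ G, g x ∈ A) ∧ (∀ x ∈ A, g x = x) ∧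
    map (forwardPattern id G) atTop = map (forwardPattern g G) atTop

lemma map_forwardPattern_comp_eq {c : BinSeq → BinSeq} {G H : Finset BinSeq}
    (h : map (forwardPattern id H) atTop = map (forwardPattern c H) atTop)
    {f : BinSeq → BinSeq} (hf : ∀ x ∈ G, f x ∈ H) :
    map (forwardPattern f G) atTop = map (forwardPattern (c ∘ f) G) atTop :=
  map_comp_eq_of_map_eq h fun s (x : G) => s ⟨f x, hf x x.2⟩

lemma ReversesPatterns.comp {e : BinSeq → BinSeq} {G H : Finset BinSeq}
    (h : ReversesPatterns e H) {f : BinSeq → BinSeq} (hf : ∀ x ∈ G, f x ∈ H) :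
    map (forwardPattern f G) atTop = map (backwardPattern (e ∘ f) G) atTop :=
  map_comp_eq_of_map_eq h fun s (x : G) => s ⟨f x, hf x x.2⟩

lemma frequently_agree_of_map_forwardPattern_eq {c d : BinSeq → BinSeq} {H : Finset BinSeq}
    (h : map (forwardPattern c H) atTop = map (forwardPattern d H) atTop)
    {G : Finset BinSeq} {f g : BinSeq → BinSeq} (hf : ∀ x ∈ G, f x ∈ H) (hg : ∀ x ∈ G, g x ∈ H) :
    (∃ᶠ k in atTop, ∀ x ∈ G, c (f x) k = c (g x) k) ↔
      ∃ᶠ k in atTop, ∀ x ∈ G, d (f x) k = d (g x) k := by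
  simpa [forwardPattern] using frequently_iff_of_map_eq h
    fun s => ∀ x : G, (s ⟨f x, hf x x.2⟩).1 = (s ⟨g x, hg x x.2⟩).1

lemma Reflecting.exists_frequently_agree {A : Set BinSeq} (hA : Reflecting A)
    (G : Finset BinSeq) : ∃ g : BinSeq → BinSeq, (∀ x ∈ G, g x ∈ A) ∧ (∀ x ∈ A, g x = x) ∧
      map (forwardPattern id G) atTop = map (forwardPattern g G) atTop ∧
      ∃ᶠ k in atTop, ∀ x ∈ G, g x k = x k := by
  classical
  choose r hrA hrid hr using hA
  let E : ℕ → Finset BinSeq := fun n => Nat.rec G (fun _ H => H ∪ G.image (r H)) n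
  have hE : ∀ n, E (n + 1) = E n ∪ G.image (r (E n)) := fun n => rfl
  have hmono : Monotone E := monotone_nat_of_le_succ fun n => by
    rw [hE]
    exact Finset.subset_union_left
  have hG : ∀ n, G ⊆ E n := fun n => hmono n.zero_le
  let U : Ultrafilter ℕ := hyperfilter ℕ
  have hU : (U : Filter ℕ) ≤ atTop := Nat.cofinite_eq_atTop ▸ hyperfilter_le_cofinite
  let lim : ℕ → G → Bool := fun n x => @decide (∀ᶠ k in (U : Filter ℕ), r (E n) x k = true)
    (Classical.dec _)
  have hlim : ∀ n, ∀ᶠ k in (U : Filter ℕ), ∀ x : G, r (E n) x k = lim n x := by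
    intro n
    refine eventually_all.2 fun x => ?_
    by_cases h : ∀ᶠ k in (U : Filter ℕ), r (E n) x k = true
    · filter_upwards [h] with k hk
      simp [lim, h, hk]
    · filter_upwards [Ultrafilter.eventually_not.2 h] with k hk
      simp [lim, h, hk]
  obtain ⟨m, n, hmn, heq⟩ : ∃ m n, m < n ∧ lim m = lim n := by
    obtain ⟨m, n, hne, h⟩ := Finite.exists_ne_map_eq_of_infinite lim
    rcases lt_or_gt_of_ne hne with h' | h'
    · exact ⟨m, n, h', h⟩
    · exact ⟨n, m, h', h.symm⟩
  have hagree : ∃ᶠ k in atTop, ∀ x ∈ G, r (E m) x k = r (E n) x k := by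
    refine Frequently.filter_mono (Eventually.frequently ?_) hU
    filter_upwards [hlim m, hlim n] with k h1 h2 x hx
    rw [h1 ⟨x, hx⟩, h2 ⟨x, hx⟩, heq]
  refine ⟨r (E m), fun x hx => hrA _ x (hG m hx), hrid _,
    map_forwardPattern_comp_eq (f := id) (hr (E m)) (hG m), ?_⟩
  have hmem : ∀ x ∈ G, r (E m) x ∈ E n := fun x hx =>
    hmono (Nat.succ_le_of_lt hmn) (by
      rw [hE]
      exact Finset.mem_union_right _ (Finset.mem_image_of_mem _ hx))
  refine (frequently_agree_of_map_forwardPattern_eq (hr (E n)) hmem (g := id) (hG n)).2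
    (hagree.mono fun k hk x hx => ?_)
  rw [hrid _ _ (hrA _ x (hG m hx))]
  exact hk x hx

lemma ReversesOn.exists_extension {A C : Set BinSeq} (hA : Reflecting A) (hC : C.Countable)
    {e : BinSeq → BinSeq} (he : ReversesOn e A) :
    ∃ e', ReversesOn e' C ∧ ∀ x ∈ A, e' x = e x := by
  classical
  obtain ⟨B, hB, -, hBC⟩ := exists_monotone_finset_seq hC
  obtain ⟨g, hg, hgg⟩ := exists_seq_dependent
    (fun n (g : BinSeq → BinSeq) => (∀ x ∈ B n, g x ∈ A) ∧ (∀ x ∈ A, g x = x) ∧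
      map (forwardPattern id (B n)) atTop = map (forwardPattern g (B n)) atTop ∧
      ∃ᶠ k in atTop, ∀ x ∈ B n, g x k = x k)
    (fun n g g' => ∃ᶠ k in atTop, ∀ x ∈ B n, g x k = g' x k)
    (hA.exists_frequently_agree _) (by
      rintro n g ⟨h1, -, -, h4⟩
      obtain ⟨g', h1', h2', h3', h4'⟩ :=
        hA.exists_frequently_agree (B (n + 1) ∪ (B n).image g)
      refine ⟨g', ⟨fun x hx => h1' x (Finset.mem_union_left _ hx), h2',
        map_forwardPattern_comp_eq (f := id) h3' fun x hx => Finset.mem_union_left _ hx,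
        h4'.mono fun k hk x hx => hk x (Finset.mem_union_left _ hx)⟩, ?_⟩
      refine ((frequently_agree_of_map_forwardPattern_eq h3' (f := g) (g := id)
        (fun x hx => Finset.mem_union_right _ (Finset.mem_image_of_mem _ hx))
        (fun x hx => Finset.mem_union_left _ (hB n.le_succ hx))).1 h4).mono fun k hk x hx => ?_
      rw [← h2' _ (h1 x hx)]
      exact hk x hx)
  obtain ⟨N, hN⟩ := exists_glued_reversesPatterns hB (c := fun n => e ∘ g n)
    (fun n => (hg n).2.2.1.trans
      ((he ((B n).image (g n)) (by
        rw [Finset.coe_image, Set.image_subset_iff]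
        exact (hg n).1)).comp fun x hx => Finset.mem_image_of_mem _ hx))
    (fun n => by
      have hsub : (((B n).image (g n) ∪ (B n).image (g (n + 1)) : Finset BinSeq) : Set BinSeq) ⊆ A := by
        simp only [Finset.coe_union, Finset.coe_image, Set.union_subset_iff, Set.image_subset_iff]
        exact ⟨(hg n).1, fun x hx => (hg (n + 1)).1 x (hB n.le_succ hx)⟩
      have h1 : ∀ x ∈ B n, g n x ∈ (B n).image (g n) ∪ (B n).image (g (n + 1)) := fun x hx =>
        Finset.mem_union_left _ (Finset.mem_image_of_mem _ hx)
      have h2 : ∀ x ∈ B n, g (n + 1) x ∈ (B n).image (g n) ∪ (B n).image (g (n + 1)) :=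
        fun x hx => Finset.mem_union_right _ (Finset.mem_image_of_mem _ hx)
      have h3 := (frequently_iff_of_map_eq (he _ hsub)
        fun s => ∀ x : B n, (s ⟨_, h1 x x.2⟩).1 = (s ⟨_, h2 x x.2⟩).1).1
          ((hgg n).mono fun k hk x => hk x x.2)
      refine (((tendsto_add_atTop_nat 1).frequently (p := fun k => ∀ x ∈ B n,
        e (g n x) k = e (g (n + 1) x) k)) (h3.mono fun k hk x hx => hk ⟨x, hx⟩)))
  refine ⟨fun x k => (e ∘ g (N k)) x k, fun G hG => ?_, fun x hx => ?_⟩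
  · obtain ⟨n, hn⟩ := hBC G hG
    exact (hN n).mono hn
  · funext k
    simp only [Function.comp_apply, (hg _).2.1 x hx]

lemma exists_countable_image_eq_range {α β : Type*} [Countable β] (τ : α → β) :
    ∃ D : Set α, D.Countable ∧ ∀ a, ∃ d ∈ D, τ d = τ a := by
  refine ⟨Set.range fun b : Set.range τ => b.2.choose, Set.countable_range _, fun a => ?_⟩
  exact ⟨_, ⟨⟨τ a, a, rfl⟩, rfl⟩, (⟨τ a, a, rfl⟩ : Set.range τ).2.choose_spec⟩

instance finite_filter {α : Type*} [Finite α] : Finite (Filter α) :=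
  Finite.of_injective Filter.sets fun _ _ => Filter.filter_eq

lemma exists_reflecting_of_closed : ∃ D : Finset BinSeq → Set BinSeq, (∀ F, (D F).Countable) ∧
    ∀ A : Set BinSeq, (∀ F : Finset BinSeq, ↑F ⊆ A → D F ⊆ A) → Reflecting A := by
  classical
  let pat : ∀ (F : Finset BinSeq) (n : ℕ), (Fin n → BinSeq) → ℕ → F ⊕ Fin n → Bool × Bool :=
    fun F n h k => Sum.elim (fun x => (x.1 k, x.1 (k + 1))) fun i => (h i k, h i (k + 1))
  choose D hD hDτ using fun (F : Finset BinSeq) (n : ℕ) =>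
    exists_countable_image_eq_range fun h : Fin n → BinSeq => map (pat F n h) atTop
  refine ⟨fun F => ⋃ n, ⋃ h ∈ D F n, Set.range h, fun F => Set.countable_iUnion fun n =>
    (hD F n).biUnion fun h _ => Set.countable_range h, fun A hA G => ?_⟩
  let F := G.filter (· ∈ A)
  have hF : (F : Set BinSeq) ⊆ A := fun x hx => (Finset.mem_filter.1 hx).2
  let φ := (G \ F).equivFin
  obtain ⟨h, hh, hτ⟩ := hDτ F (G \ F).card fun i => (φ.symm i : BinSeq)
  have hGF : ∀ x ∈ G, x ∉ A → x ∈ G \ F := fun x hx hxA =>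
    Finset.mem_sdiff.2 ⟨hx, fun h => hxA (hF h)⟩
  have hhA : ∀ i, h i ∈ A := fun i => hA F hF
    (Set.mem_iUnion.2 ⟨_, Set.mem_iUnion₂.2 ⟨h, hh, Set.mem_range_self i⟩⟩)
  refine ⟨fun x => if hx : x ∈ G \ F then h (φ ⟨x, hx⟩) else x, fun x hx => ?_, fun x hx => ?_, ?_⟩
  · beta_reduce
    split_ifs with hxF
    · exact hhA _
    · by_contra hxA
      exact hxF (hGF x hx hxA)
  · refine dif_neg fun hxF => ?_
    have := Finset.mem_sdiff.1 hxF
    exact this.2 (Finset.mem_filter.2 ⟨this.1, hx⟩)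
  · have hmem : ∀ x ∈ G, x ∉ G \ F → x ∈ F := fun x hx hxF => by
      by_contra h
      exact hxF (Finset.mem_sdiff.2 ⟨hx, h⟩)
    have := map_comp_eq_of_map_eq hτ.symm fun s (x : G) =>
      if hx : x.1 ∈ G \ F then s (Sum.inr (φ ⟨x, hx⟩)) else s (Sum.inl ⟨x, hmem x x.2 hx⟩)
    convert this using 2
    · funext k x
      by_cases hx : x.1 ∈ G \ F <;> simp only [forwardPattern, pat, hx, dif_pos, dif_neg, not_false_eq_true, Sum.elim_inl, Sum.elim_inr, Equiv.symm_apply_apply, id]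
    · funext k x
      by_cases hx : x.1 ∈ G \ F <;> simp only [forwardPattern, pat, hx, dif_pos, dif_neg, not_false_eq_true, Sum.elim_inl, Sum.elim_inr]

lemma exists_countable_closed_superset {α : Type*} {D : Finset α → Set α}
    (hD : ∀ F, (D F).Countable) {S : Set α} (hS : S.Countable) :
    ∃ J, S ⊆ J ∧ J.Countable ∧ ∀ F : Finset α, ↑F ⊆ J → D F ⊆ J := by
  let step : Set α → Set α := fun T => T ∪ ⋃ F ∈ {F : Finset α | ↑F ⊆ T}, D F
  have hstep : ∀ T : Set α, T.Countable → (step T).Countable := by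
    intro T hT
    refine hT.union (Set.Countable.biUnion ?_ fun F _ => hD F)
    have := (Set.countable_ofPred_finite_subset hT).preimage_of_injOn
      (f := fun F : Finset α => (F : Set α)) Finset.coe_injective.injOn
    exact this.mono fun F hF => show _ ∧ _ from ⟨F.finite_toSet, hF⟩
  let E : ℕ → Set α := fun n => step^[n] S
  have hE : ∀ n, E (n + 1) = step (E n) := fun n => Function.iterate_succ_apply' step n S
  have hmono : Monotone E := monotone_nat_of_le_succ fun n => by
    rw [hE]
    exact Set.subset_union_left
  have hcount : ∀ n, (E n).Countable := fun n => by
    induction n with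
    | zero => exact hS
    | succ n ih =>
      rw [hE]
      exact hstep _ ih
  refine ⟨⋃ n, E n, Set.subset_iUnion E 0, Set.countable_iUnion hcount, fun F hF => ?_⟩
  obtain ⟨n, hn⟩ := hmono.directed_le.exists_mem_subset_of_finset_subset_biUnion hF
  refine Set.Subset.trans ?_ (Set.subset_iUnion E (n + 1))
  rw [hE]
  exact (Set.subset_biUnion_of_mem (u := D) (show F ∈ {F : Finset α | ↑F ⊆ E n} from hn)).trans
    Set.subset_union_right

lemma exists_wellOrder_countable_initialSegments {α : Type*} (h : Cardinal.mk α = Cardinal.aleph 1) :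
    ∃ r : α → α → Prop, IsWellOrder α r ∧ ∀ x, {y | r y x}.Countable := by
  obtain ⟨r, hwo, hr⟩ := Cardinal.exists_ord_eq α
  refine ⟨r, hwo, fun x => ?_⟩
  have := Cardinal.card_typein_lt x hr
  rw [h, ← Cardinal.succ_aleph0, Order.lt_succ_iff] at this
  rw [← Cardinal.le_aleph0_iff_set_countable]
  exact this

lemma exists_reversesOn_univ (CH : Cardinal.continuum.{0} = Cardinal.aleph 1) :
    ∃ e, ReversesOn e Set.univ := by
  classical
  obtain ⟨r, hr, hcount⟩ := exists_wellOrder_countable_initialSegments (α := BinSeq) (by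
    rw [← CH]
    simp)
  obtain ⟨D₀, hD₀, hrefl⟩ := exists_reflecting_of_closed
  let D : Finset BinSeq → Set BinSeq := fun F => D₀ F ∪ ⋃ x ∈ F, {y | r y x}
  have hD : ∀ F, (D F).Countable := fun F =>
    (hD₀ F).union (F.countable_toSet.biUnion fun x _ => hcount x)
  let Closed : Set BinSeq → Prop := fun A => ∀ F : Finset BinSeq, ↑F ⊆ A → D F ⊆ A
  have hreflecting : ∀ A, Closed A → Reflecting A := fun A hA =>
    hrefl A fun F hF => Set.subset_union_left.trans (hA F hF)
  let T := {s : Set BinSeq × (BinSeq → BinSeq) // Closed s.1 ∧ ReversesOn s.2 s.1}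
  have hT : Nonempty T := by
    obtain ⟨A, -, hA, hclosed⟩ := exists_countable_closed_superset hD Set.countable_empty
    obtain ⟨e, he⟩ := exists_reversesOn_of_countable hA
    exact ⟨⟨(A, e), hclosed, he⟩⟩
  obtain ⟨⟨⟨A, e⟩, hA, he⟩, hmax⟩ := exists_maximal_of_chains_bounded
    (r := fun s t : T => s.1.1 ⊆ t.1.1 ∧ ∀ x ∈ s.1.1, s.1.2 x = t.1.2 x) (by
      intro c hc
      rcases c.eq_empty_or_nonempty with rfl | hne
      · exact ⟨hT.some, by simp⟩
      have hdir : DirectedOn (fun s t : T => s.1.1 ⊆ t.1.1) c := by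
        intro s hs t ht
        rcases eq_or_ne s t with rfl | hst
        · exact ⟨s, hs, subset_rfl, subset_rfl⟩
        · rcases hc hs ht hst with h | h
          · exact ⟨t, ht, h.1, subset_rfl⟩
          · exact ⟨s, hs, subset_rfl, h.1⟩
      have hex : ∀ x, ∃ y, ∀ s ∈ c, x ∈ s.1.1 → s.1.2 x = y := by
        intro x
        by_cases h : ∃ s ∈ c, x ∈ s.1.1
        · obtain ⟨s, hs, hx⟩ := h
          refine ⟨s.1.2 x, fun t ht hxt => ?_⟩
          rcases eq_or_ne s t with rfl | hst
          · rfl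
          · rcases hc hs ht hst with h | h
            · exact (h.2 x hx).symm
            · exact h.2 x hxt
        · exact ⟨x, fun s hs hx => absurd ⟨s, hs, hx⟩ h⟩
      choose e he using hex
      refine ⟨⟨(⋃ s ∈ c, s.1.1, e), fun F hF => ?_, fun F hF => ?_⟩, fun s hs => ⟨?_, ?_⟩⟩
      · obtain ⟨s, hs, hFs⟩ := hdir.exists_mem_subset_of_finset_subset_biUnion hne hF
        exact (s.2.1 F hFs).trans (Set.subset_biUnion_of_mem (u := fun s : T => s.1.1) hs)
      · obtain ⟨s, hs, hFs⟩ := hdir.exists_mem_subset_of_finset_subset_biUnion hne hF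
        exact (s.2.2 F hFs).congr fun x hx => he x s hs (hFs hx)
      · exact Set.subset_biUnion_of_mem (u := fun s : T => s.1.1) hs
      · exact fun x hx => he x s hs hx)
    (fun {a b c} hab hbc => ⟨hab.1.trans hbc.1, fun x hx => (hab.2 x hx).trans (hbc.2 x (hab.1 hx))⟩)
  rcases eq_or_ne A Set.univ with rfl | hne
  · exact ⟨e, he⟩
  · obtain ⟨i, hi⟩ := (Set.ne_univ_iff_exists_notMem A).1 hne
    have hAi : A ⊆ {y | r y i} := by
      intro y hy
      rcases trichotomous_of r y i with h | h | h
      · exact h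
      · exact absurd (h ▸ hy) hi
      · refine absurd (hA {y} (by simpa using hy) ?_) hi
        exact Or.inr (by simpa using h)
    obtain ⟨C, hC, hCc, hclosed⟩ := exists_countable_closed_superset hD
      (((hcount i).mono hAi).insert i)
    obtain ⟨e', he', hee'⟩ := ReversesOn.exists_extension (hreflecting A hA) hCc he
    have := hmax ⟨(C, e'), hclosed, he'⟩
      ⟨(Set.subset_insert i A).trans hC, fun x hx => (hee' x hx).symm⟩
    exact absurd (this.1 (hC (Set.mem_insert i A))) hi

lemma ReversesOn.eventually_iff {e : BinSeq → BinSeq} (he : ReversesOn e Set.univ)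
    (x y z : BinSeq) (P : Bool × Bool → Bool × Bool → Bool × Bool → Prop) :
    (∀ᶠ k in atTop, P (x k, x (k + 1)) (y k, y (k + 1)) (z k, z (k + 1))) ↔
      ∀ᶠ k in atTop, P (e x (k + 1), e x k) (e y (k + 1), e y k) (e z (k + 1), e z k) := by
  classical
  exact eventually_iff_of_map_eq (he {x, y, z} (Set.subset_univ _))
    fun s => P (s ⟨x, by simp⟩) (s ⟨y, by simp⟩) (s ⟨z, by simp⟩)

lemma ReversesOn.eventually_value_iff {e : BinSeq → BinSeq} (he : ReversesOn e Set.univ)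
    (x y z : BinSeq) (P : Bool → Bool → Bool → Prop) :
    (∀ᶠ k in atTop, P (x k) (y k) (z k)) ↔ ∀ᶠ k in atTop, P (e x k) (e y k) (e z k) :=
  (he.eventually_iff x y z fun a b c => P a.1 b.1 c.1).trans <| by
    rw [← eventually_map (m := (· + 1)) (P := fun k => P (e x k) (e y k) (e z k)),
      map_add_atTop_eq_nat]

lemma ReversesOn.eventually_shift {e : BinSeq → BinSeq} (he : ReversesOn e Set.univ)
    (x : BinSeq) : ∀ᶠ k in atTop, e (fun j => x (j + 1)) (k + 1) = e x k :=
  (he.eventually_iff x (fun j => x (j + 1)) x fun a b _ => b.1 = a.2).1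
    (Eventually.of_forall fun _ => rfl)

/-- Every permutation is conjugate to its inverse by an involution. -/
lemma exists_involutive_conj_inv {α : Type*} (τ : Equiv.Perm α) :
    ∃ π : α → α, Function.Involutive π ∧ ∀ x, τ (π (τ x)) = π x := by
  let rep : α → α := fun x => (Quotient.mk (Equiv.Perm.SameCycle.setoid τ) x).out
  have hrep : ∀ x, ∃ i : ℤ, (τ ^ i) (rep x) = x := fun x => Quotient.mk_out (s := Equiv.Perm.SameCycle.setoid τ) x
  have hrepeq : ∀ x (i : ℤ), rep ((τ ^ i) x) = rep x := fun x i =>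
    congrArg Quotient.out (Quotient.sound (s := Equiv.Perm.SameCycle.setoid τ)
      (Equiv.Perm.sameCycle_zpow_left.2 (Equiv.Perm.SameCycle.refl τ x)))
  choose i hi using hrep
  have key : ∀ x (j k : ℤ), (τ ^ j) x = (τ ^ k) x → (τ ^ (-j)) x = (τ ^ (-k)) x := by
    intro x j k h
    have h1 := congrArg (τ ^ (-j - k)) h
    rw [← Equiv.Perm.mul_apply, ← Equiv.Perm.mul_apply, ← zpow_add, ← zpow_add] at h1
    rw [show -j = -j - k + k by ring, ← h1]
    congr 2
    ring
  have hπ : ∀ x (j : ℤ), (τ ^ (-i ((τ ^ j) (rep x)))) (rep x) = (τ ^ (-j)) (rep x) := by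
    intro x j
    apply key
    have := hi ((τ ^ j) (rep x))
    rw [hrepeq] at this
    have hrr : rep (rep x) = rep x := by
      conv_rhs => rw [← hi x, hrepeq]
    rwa [hrr] at this
  refine ⟨fun x => (τ ^ (-i x)) (rep x), fun x => ?_, fun x => ?_⟩
  · have hrr : rep ((τ ^ (-i x)) (rep x)) = rep x := by
      conv_rhs => rw [← hi x]
      rw [hrepeq, hrepeq]
    simp only [hrr]
    rw [hπ x (-i x), neg_neg, hi]
  · have h1 : rep (τ x) = rep x := by simpa using hrepeq x 1
    have h2 : τ x = (τ ^ (1 + i x)) (rep x) := by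
      rw [zpow_add, Equiv.Perm.mul_apply, hi, zpow_one]
    have h3 := hπ x (1 + i x)
    simp only [h1]
    rw [← h2] at h3
    rw [h3]
    nth_rewrite 1 [← zpow_one τ]
    rw [← Equiv.Perm.mul_apply, ← zpow_add]
    congr 2
    ring

section OneSided

variable {q : ℕ → ℕ}

lemma iterate_injective_of_notMem_range (hq : Function.Injective q) {r s i j : ℕ}
    (hr : r ∉ Set.range q) (hs : s ∉ Set.range q) (h : q^[i] r = q^[j] s) : r = s ∧ i = j := by
  induction i generalizing j with
  | zero =>
    cases j with
    | zero => exact ⟨h, rfl⟩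
    | succ j =>
      rw [Function.iterate_succ_apply'] at h
      exact absurd ⟨_, h.symm⟩ hr
  | succ i ih =>
    cases j with
    | zero =>
      rw [Function.iterate_succ_apply'] at h
      exact absurd ⟨_, h⟩ hs
    | succ j =>
      rw [Function.iterate_succ_apply', Function.iterate_succ_apply'] at h
      obtain ⟨h1, h2⟩ := ih (hq h)
      exact ⟨h1, by rw [h2]⟩

/-- The points whose backward orbit under `q` never ends. -/
def backwardInfinite (q : ℕ → ℕ) : Set ℕ :=
  {k | ∀ r ∉ Set.range q, ∀ i, q^[i] r ≠ k}

lemma apply_mem_backwardInfinite_iff (hq : Function.Injective q) {k : ℕ} :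
    q k ∈ backwardInfinite q ↔ k ∈ backwardInfinite q := by
  refine ⟨fun h r hr i hi => h r hr (i + 1) ?_, fun h r hr i hi => ?_⟩
  · rw [Function.iterate_succ_apply', hi]
  · cases i with
    | zero => exact hr ⟨k, hi.symm⟩
    | succ i =>
      rw [Function.iterate_succ_apply'] at hi
      exact h r hr i (hq hi)

lemma exists_perm_backwardInfinite (hq : Function.Injective q) :
    ∃ τ : Equiv.Perm (backwardInfinite q), ∀ z, (τ z : ℕ) = q z := by
  let f : backwardInfinite q → backwardInfinite q := fun z =>
    ⟨q z, (apply_mem_backwardInfinite_iff hq).2 z.2⟩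
  refine ⟨Equiv.ofBijective f ⟨fun a b h => ?_, fun b => ?_⟩, fun z => rfl⟩
  · exact Subtype.ext (hq (congrArg Subtype.val h))
  · have hb : (b : ℕ) ∈ Set.range q := by
      by_contra h
      exact b.2 b h 0 rfl
    obtain ⟨a, ha⟩ := hb
    exact ⟨⟨a, (apply_mem_backwardInfinite_iff hq).1 (ha ▸ b.2)⟩, Subtype.ext ha⟩

lemma eventually_cofinite_iff_orbits (hq : Function.Injective q) (hfin : (Set.range q)ᶜ.Finite)
    (P : ℕ → Prop) : (∀ᶠ k in cofinite, P k) ↔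
      (∀ r ∉ Set.range q, ∀ᶠ i in atTop, P (q^[i] r)) ∧
        ∀ᶠ z : backwardInfinite q in cofinite, P z := by
  refine ⟨fun h => ⟨fun r hr => ?_, Subtype.val_injective.tendsto_cofinite.eventually h⟩, ?_⟩
  · have hinj : Function.Injective fun i => q^[i] r := fun i j hij =>
      (iterate_injective_of_notMem_range hq hr hr hij).2
    rw [← Nat.cofinite_eq_atTop]
    exact hinj.tendsto_cofinite.eventually h
  · rintro ⟨h1, h2⟩
    have h1' : ∀ r ∈ (Set.range q)ᶜ, {i | ¬ P (q^[i] r)}.Finite := fun r hr => by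
      have := h1 r hr
      rwa [← Nat.cofinite_eq_atTop] at this
    refine ((hfin.biUnion fun r hr => (h1' r hr).image fun i => q^[i] r).union
      (h2.image Subtype.val)).subset fun k hk => ?_
    by_cases hkZ : k ∈ backwardInfinite q
    · exact Or.inr ⟨⟨k, hkZ⟩, hk, rfl⟩
    · simp only [backwardInfinite, Set.mem_ofPred_eq, not_forall, not_not] at hkZ
      obtain ⟨r, hr, i, rfl⟩ := hkZ
      exact Or.inl (Set.mem_biUnion (x := r) hr ⟨i, hk, rfl⟩)

lemma exists_equivariant_embedding {e : BinSeq → BinSeq} (he : ReversesOn e Set.univ)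
    (hq : Function.Injective q) (hfin : (Set.range q)ᶜ.Finite) :
    ∃ E : BinSeq → BinSeq,
      (∀ x y z (P : Bool → Bool → Bool → Prop), (∀ᶠ k in cofinite, P (x k) (y k) (z k)) ↔
        ∀ᶠ k in cofinite, P (E x k) (E y k) (E z k)) ∧
      ∀ x, ∀ᶠ k in cofinite, E (x ∘ q) (q k) = E x k := by
  obtain ⟨τ, hτ⟩ := exists_perm_backwardInfinite hq
  obtain ⟨π, hπ, hconj⟩ := exists_involutive_conj_inv τ
  have hval : ∀ (x : BinSeq) (k : ℕ), ∃ b : Bool,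
      (∀ r ∉ Set.range q, ∀ i, q^[i] r = k → b = e (fun j => x (q^[j] r)) i) ∧
        ∀ h : k ∈ backwardInfinite q, b = x (π ⟨k, h⟩) := by
    intro x k
    by_cases hk : k ∈ backwardInfinite q
    · exact ⟨x (π ⟨k, hk⟩), fun r hr i hi => absurd hi (hk r hr i), fun _ => rfl⟩
    · have hk' := hk
      simp only [backwardInfinite, Set.mem_ofPred_eq, not_forall, not_not] at hk'
      obtain ⟨r, hr, i, rfl⟩ := hk'
      refine ⟨e (fun j => x (q^[j] r)) i, fun s hs j hj => ?_, fun h => absurd h hk⟩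
      obtain ⟨rfl, rfl⟩ := iterate_injective_of_notMem_range hq hs hr hj
      rfl
  choose E hE hEZ using hval
  have hEorb : ∀ x, ∀ r ∉ Set.range q, ∀ i, E x (q^[i] r) = e (fun j => x (q^[j] r)) i :=
    fun x r hr i => hE x _ r hr i rfl
  have hEinf : ∀ x (z : backwardInfinite q), E x z = x (π z) := fun x z => hEZ x z z.2
  refine ⟨E, fun x y z P => ?_, fun x => ?_⟩
  · rw [eventually_cofinite_iff_orbits hq hfin, eventually_cofinite_iff_orbits hq hfin]
    refine and_congr (forall₂_congr fun r hr => ?_) ?_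
    · simp only [hEorb _ r hr]
      exact he.eventually_value_iff (fun j => x (q^[j] r)) (fun j => y (q^[j] r))
        (fun j => z (q^[j] r)) P
    · simp only [hEinf]
      refine ⟨fun h => hπ.injective.tendsto_cofinite.eventually h, fun h => ?_⟩
      simpa only [hπ _] using hπ.injective.tendsto_cofinite.eventually h
  · rw [eventually_cofinite_iff_orbits hq hfin]
    refine ⟨fun r hr => ?_, Eventually.of_forall fun z => ?_⟩
    · filter_upwards [he.eventually_shift fun j => x (q^[j] r)] with i hi
      rw [← Function.iterate_succ_apply' q, hEorb _ r hr, hEorb _ r hr, ← hi]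
      simp only [Function.comp_apply, ← Function.iterate_succ_apply' q]
    · rw [← hτ, hEinf, hEinf, Function.comp_apply, ← hτ, hconj]

end OneSided

lemma exists_continuous_surjective_of_embedding {E : BinSeq → BinSeq}
    (hE : ∀ x y z (P : Bool → Bool → Bool → Prop), (∀ᶠ k in cofinite, P (x k) (y k) (z k)) ↔
        ∀ᶠ k in cofinite, P (E x k) (E y k) (E z k)) :
    ∃ Q : FreeUF ℕ → FreeUF ℕ, Continuous Q ∧ Function.Surjective Q ∧
      ∀ (U : FreeUF ℕ) (x : BinSeq), (∀ᶠ k in ((Q U).1 : Filter ℕ), x k = true) ↔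
        ∀ᶠ k in (U.1 : Filter ℕ), E x k = true := by
  classical
  let χ : Set ℕ → BinSeq := fun S k => decide (k ∈ S)
  have hdual : ∀ (U : FreeUF ℕ) (S : Set ℕ),
      (∀ᶠ k in (U.1 : Filter ℕ), E (χ Sᶜ) k = true) ↔ ∀ᶠ k in (U.1 : Filter ℕ), ¬ E (χ S) k = true := by
    intro U S
    refine eventually_congr (U.2 ?_)
    refine (hE (χ S) (χ Sᶜ) (χ S) fun a b _ => b = true ↔ ¬ a = true).1
      (Eventually.of_forall fun k => ?_)
    simp [χ]
  have hmono : ∀ (U : FreeUF ℕ) {S T : Set ℕ}, S ⊆ T →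
      (∀ᶠ k in (U.1 : Filter ℕ), E (χ S) k = true) → ∀ᶠ k in (U.1 : Filter ℕ), E (χ T) k = true := by
    intro U S T hST h
    have h1 := U.2 ((hE (χ S) (χ T) (χ S) fun a b _ => a = true → b = true).1
      (Eventually.of_forall fun k hk => by
        simp only [χ, decide_eq_true_eq] at hk ⊢
        exact hST hk))
    filter_upwards [h, h1] with k hk hk1 using hk1 hk
  let F : FreeUF ℕ → Filter ℕ := fun U =>
    { sets := {S | ∀ᶠ k in (U.1 : Filter ℕ), E (χ S) k = true}
      univ_sets := U.2 ((hE (χ Set.univ) (χ Set.univ) (χ Set.univ) fun a _ _ => a = true).1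
        (Eventually.of_forall fun k => by simp [χ]))
      sets_of_superset := fun {S T} hS hST => hmono U hST hS
      inter_sets := fun {S T} hS hT => by
        have h1 := U.2 ((hE (χ S) (χ T) (χ (S ∩ T)) fun a b c => a = true → b = true → c = true).1
          (Eventually.of_forall fun k => by
            simp only [χ, decide_eq_true_eq]
            exact fun h h' => ⟨h, h'⟩))
        simp only [Set.mem_ofPred_eq] at hS hT ⊢
        filter_upwards [hS, hT, h1] with k hk hk' hk1 using hk1 hk hk' }
  have hFmem : ∀ U S, S ∈ F U ↔ ∀ᶠ k in (U.1 : Filter ℕ), E (χ S) k = true := fun _ _ => Iff.rfl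
  let Q : FreeUF ℕ → FreeUF ℕ := fun U =>
    ⟨Ultrafilter.ofComplNotMemIff (F U) fun S => by
      simp only [hFmem, hdual, ← Ultrafilter.eventually_not, not_not], fun S hS => by
        refine U.2 ((hE (χ S) (χ S) (χ S) fun a _ _ => a = true).1 ?_)
        filter_upwards [hS] with k hk
        simpa [χ] using hk⟩
  have hQmem : ∀ U S, S ∈ (Q U).1 ↔ ∀ᶠ k in (U.1 : Filter ℕ), E (χ S) k = true := fun _ _ => Iff.rfl
  refine ⟨Q, ?_, fun V => ?_, fun U x => ?_⟩
  · refine Continuous.subtype_mk ?_ _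
    refine continuous_generateFrom_iff.2 ?_
    rintro _ ⟨S, rfl⟩
    exact (ultrafilter_isOpen_basic {k | E (χ S) k = true}).preimage continuous_subtype_val
  · let G : Filter ℕ :=
      { sets := {T | ∃ S ∈ V.1, ∀ᶠ k in cofinite, E (χ S) k = true → k ∈ T}
        univ_sets := ⟨Set.univ, univ_mem, Eventually.of_forall fun _ _ => trivial⟩
        sets_of_superset := fun {S T} ⟨R, hR, h⟩ hST =>
          ⟨R, hR, h.mono fun k hk hk' => hST (hk hk')⟩
        inter_sets := fun {S T} ⟨R, hR, h⟩ ⟨R', hR', h'⟩ => by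
          refine ⟨R ∩ R', inter_mem hR hR', ?_⟩
          have h1 := (hE (χ R) (χ R') (χ (R ∩ R')) fun a b c => c = true → a = true ∧ b = true).1
            (Eventually.of_forall fun k => by
              simp only [χ, decide_eq_true_eq]
              exact fun h => h)
          filter_upwards [h, h', h1] with k hk hk' hk1 hc
            using ⟨hk (hk1 hc).1, hk' (hk1 hc).2⟩ }
    have hG : G.NeBot := by
      refine ⟨fun hbot => ?_⟩
      obtain ⟨S, hS, h⟩ : (∅ : Set ℕ) ∈ G := hbot ▸ mem_bot
      have h1 := (hE (χ S) (χ S) (χ S) fun a _ _ => ¬ a = true).2 (h.mono fun k hk hk' => hk hk')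
      have h2 : Sᶜ ∈ V.1 := V.2 (h1.mono fun k hk => by simpa [χ] using hk)
      exact V.1.compl_notMem_iff.2 hS h2
    let U : FreeUF ℕ := ⟨Ultrafilter.of G, (Ultrafilter.of_le G).trans fun T hT =>
      ⟨Set.univ, univ_mem, Filter.mem_of_superset hT fun k hk _ => hk⟩⟩
    refine ⟨U, Subtype.ext (Ultrafilter.eq_of_le fun S hS => ?_)⟩
    exact Ultrafilter.of_le G ⟨S, hS, Eventually.of_forall fun k hk => hk⟩
  · have : χ {k | x k = true} = x := by
      funext k
      simp [χ]
    refine (hQmem U {k | x k = true}).trans ?_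
    rw [this]

lemma exists_quotient_of_injective (CH : Cardinal.continuum.{0} = Cardinal.aleph 1) {q : ℕ → ℕ}
    (hq : Function.Injective q) (hfin : (Set.range q)ᶜ.Finite) :
    ∃ Q : FreeUF ℕ → FreeUF ℕ, Continuous Q ∧ Function.Surjective Q ∧
      ∀ U : FreeUF ℕ, Q U = ufMap q (finiteToOne_of_injective hq)
        (Q (ufMap q (finiteToOne_of_injective hq) U)) := by
  classical
  obtain ⟨e, he⟩ := exists_reversesOn_univ CH
  obtain ⟨E, hE, hEq⟩ := exists_equivariant_embedding he hq hfin
  obtain ⟨Q, hQc, hQs, hQ⟩ := exists_continuous_surjective_of_embedding hE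
  refine ⟨Q, hQc, hQs, fun U => Subtype.ext (Ultrafilter.ext fun S => ?_)⟩
  have h1 := hQ U fun k => decide (k ∈ S)
  have h2 := hQ (ufMap q (finiteToOne_of_injective hq) U) ((fun k => decide (k ∈ S)) ∘ q)
  have h3 : (∀ᶠ k in (U.1 : Filter ℕ), E ((fun k => decide (k ∈ S)) ∘ q) (q k) = true) ↔
      ∀ᶠ k in (U.1 : Filter ℕ), E (fun k => decide (k ∈ S)) k = true :=
    eventually_congr (((hEq _).filter_mono U.2).mono fun k hk => by rw [hk])
  simp only [Function.comp_apply, decide_eq_true_eq] at h1 h2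
  exact h1.trans (h3.symm.trans h2.symm)

lemma exists_injective_extension {p : ℕ → ℕ} {A B : Set ℕ} (hA : Aᶜ.Finite)
    (hp : Set.BijOn p A B) (hle : Aᶜ.encard ≤ Bᶜ.encard) :
    ∃ q : ℕ → ℕ, Function.Injective q ∧ Set.EqOn q p A ∧ B ⊆ Set.range q := by
  classical
  obtain ⟨f, hf, hfinj⟩ := hA.exists_injOn_of_encard_le hle
  have hfB : ∀ x ∉ A, f x ∉ B := fun x hx => hf hx
  refine ⟨A.piecewise p f, ?_, A.piecewise_eqOn p f, fun y hy => ?_⟩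
  · intro x y hxy
    by_cases hx : x ∈ A <;> by_cases hy : y ∈ A <;> simp only [hx, hy, Set.piecewise_eq_of_mem, Set.piecewise_eq_of_notMem, not_false_eq_true] at hxy
    · exact hp.injOn hx hy hxy
    · exact absurd (hxy ▸ hp.mapsTo hx) (hfB y hy)
    · exact absurd (hxy ▸ hp.mapsTo hy) (hfB x hx)
    · exact hfinj hx hy hxy
  · obtain ⟨x, hx, rfl⟩ := hp.surjOn hy
    exact ⟨x, Set.piecewise_eq_of_mem _ _ _ hx⟩

lemma ufMap_congr {f g : ℕ → ℕ} (hf : ∀ n, (f ⁻¹' {n}).Finite) (hg : ∀ n, (g ⁻¹' {n}).Finite)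
    (h : f =ᶠ[cofinite] g) (U : FreeUF ℕ) : ufMap f hf U = ufMap g hg U :=
  Subtype.ext (Ultrafilter.coe_injective (map_congr (U.2 h)))

lemma ufMap_ufMap_of_comp_eq {f g : ℕ → ℕ} (hf : ∀ n, (f ⁻¹' {n}).Finite)
    (hg : ∀ n, (g ⁻¹' {n}).Finite) (h : f ∘ g =ᶠ[cofinite] id) (U : FreeUF ℕ) :
    ufMap f hf (ufMap g hg U) = U := by
  refine Subtype.ext (Ultrafilter.coe_injective ?_)
  change map f (map g U.1) = U.1
  rw [map_map, map_congr (U.2 h), map_id]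

/-- Under CH, every trivial autohomeomorphism of `ℕ*` is a quotient of its inverse.  Here
`p` is a mod-finite permutation of `ℕ` (a finite-to-one map restricting to a bijection
between two cofinite sets), so that `p*` is a homeomorphism of `ℕ*`; the condition
`∀ U, Q U = p* (Q (p* U))` expresses `Q ∘ (p*)⁻¹ = p* ∘ Q`. -/
theorem trivial_map_quotient_of_inverse (CH : Cardinal.continuum = Cardinal.aleph 1)
    (p : ℕ → ℕ) (hp : ∀ n : ℕ, (p ⁻¹' {n}).Finite)
    (hperm : ∃ A B : Set ℕ, Aᶜ.Finite ∧ Bᶜ.Finite ∧ Set.BijOn p A B) :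
    ∃ Q : FreeUF ℕ → FreeUF ℕ, Continuous Q ∧ Function.Surjective Q ∧
      ∀ U : FreeUF ℕ, Q U = ufMap p hp (Q (ufMap p hp U)) := by
  have CH₀ : Cardinal.continuum.{0} = Cardinal.aleph 1 := by
    apply Cardinal.lift_injective
    rw [Cardinal.lift_continuum, CH, Cardinal.lift_aleph, Ordinal.lift_one]
  obtain ⟨A, B, hA, hB, hbij⟩ := hperm
  rcases le_total Aᶜ.encard Bᶜ.encard with hle | hle
  · obtain ⟨q, hq, hqp, hBq⟩ := exists_injective_extension hA hbij hle
    obtain ⟨Q, hQc, hQs, hQ⟩ := exists_quotient_of_injective CH₀ hq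
      (hB.subset (Set.compl_subset_compl.2 hBq))
    have hpq : p =ᶠ[cofinite] q := mem_of_superset (by simpa using hA) fun k hk => (hqp hk).symm
    refine ⟨Q, hQc, hQs, fun U => ?_⟩
    simpa only [ufMap_congr hp (finiteToOne_of_injective hq) hpq] using hQ U
  · have hinv : Set.InvOn (Function.invFunOn p A) p A B := hbij.invOn_invFunOn
    have hbij' : Set.BijOn (Function.invFunOn p A) B A :=
      hinv.symm.bijOn hbij.surjOn.mapsTo_invFunOn hbij.mapsTo
    obtain ⟨q, hq, hqp, hAq⟩ := exists_injective_extension hB hbij' hle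
    have hq1 := finiteToOne_of_injective hq
    obtain ⟨Q, hQc, hQs, hQ⟩ := exists_quotient_of_injective CH₀ hq
      (hA.subset (Set.compl_subset_compl.2 hAq))
    have hpq : p ∘ q =ᶠ[cofinite] id := mem_of_superset (by simpa using hB) fun k hk => by
      change p (q k) = k
      rw [hqp hk, hinv.2 hk]
    have hqp' : q ∘ p =ᶠ[cofinite] id := mem_of_superset (by simpa using hA) fun k hk => by
      change q (p k) = k
      rw [hqp (hbij.mapsTo hk), hinv.1 hk]
    refine ⟨Q, hQc, hQs, fun U => ?_⟩
    rw [hQ (ufMap p hp U), ufMap_ufMap_of_comp_eq hp hq1 hpq, ufMap_ufMap_of_comp_eq hq1 hp hqp']
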